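/- arXiv:0710.5290 — 3 statements merged into one kernel-verified Lean document; each statement's English description precedes it below -/
import Mathlib

section
/- Let L be the free Lie algebra over a field K of characteristic zero on two generators e and f. Let φ : L → L be a Lie algebra endomorphism and a, b ∈ K scalars such that φ(e) − a•e ∈ L^2 and φ(f) − b•f ∈ L^2, where L^2 = ⁅L, L⁆. Then for all natural numbers i, j and every l ∈ L_{i,j}, one has φ(l) − a^i b^j • l ∈ L_{≥i+1,≥j} + L_{≥i,≥j+1}; in particular, for l ∈ L_{i,j} with i, j ≥ n, φ(l) ≡ a^i b^j • l modulo L_{≥n,≥n}. -/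
noncomputable section

namespace CMPaper

variable (K : Type*) [Field K] [CharZero K]

/-- The free Lie algebra on two generators. -/
abbrev L := FreeLieAlgebra K (Fin 2)

/-- The first generator `e`. -/
def e : L K := FreeLieAlgebra.of K (0 : Fin 2)

/-- The second generator `f`. -/
def f : L K := FreeLieAlgebra.of K (1 : Fin 2)

/-- Iterated Lie bracket monomials in the generators in which `e` occurs exactly `i`
times and `f` occurs exactly `j` times. -/
inductive IsLieMonomial : L K → ℕ → ℕ → Prop
  | gen_e : IsLieMonomial (e K) 1 0
  | gen_f : IsLieMonomial (f K) 0 1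
  | brak {x y : L K} {i j k l : ℕ} :
      IsLieMonomial x i j → IsLieMonomial y k l → IsLieMonomial ⁅x, y⁆ (i + k) (j + l)

/-- The bigraded component `L_{i,j}`: the `K`-span of the Lie monomials of bidegree `(i,j)`. -/
def bihom (i j : ℕ) : Submodule K (L K) :=
  Submodule.span K {x : L K | IsLieMonomial K x i j}

/-- `L_{≥n,≥m}`: the submodule generated by all `L_{i,j}` with `i ≥ n`, `j ≥ m`. -/
def bihomGE (n m : ℕ) : Submodule K (L K) :=
  ⨆ (i : ℕ) (j : ℕ) (_ : n ≤ i) (_ : m ≤ j), bihom K i j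

/-- The lower central series, normalized so that `lcs 1 = L` and `lcs (n+1) = ⁅L, lcs n⁆`. -/
def lcs (n : ℕ) : LieIdeal K (L K) := LieModule.lowerCentralSeries K (L K) (L K) (n - 1)

set_option linter.unusedSectionVars false

theorem aux_lie_span {S T : Set (L K)} {U : Submodule K (L K)}
    (h : ∀ x ∈ S, ∀ y ∈ T, ⁅x, y⁆ ∈ U) {x y : L K}
    (hx : x ∈ Submodule.span K S) (hy : y ∈ Submodule.span K T) : ⁅x, y⁆ ∈ U := by
  induction hx using Submodule.span_induction with
  | mem x hx =>
    induction hy using Submodule.span_induction with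
    | mem y hy => exact h x hx y hy
    | zero => simp
    | add a b _ _ ha hb => rw [lie_add]; exact U.add_mem ha hb
    | smul t a _ ha => rw [lie_smul]; exact U.smul_mem _ ha
  | zero => simp
  | add a b _ _ ha hb => rw [add_lie]; exact U.add_mem ha hb
  | smul t a _ ha => rw [smul_lie]; exact U.smul_mem _ ha

theorem aux_bihomGE_eq (n m : ℕ) : bihomGE K n m =
    Submodule.span K {x : L K | ∃ i j, n ≤ i ∧ m ≤ j ∧ IsLieMonomial K x i j} := by
  apply le_antisymm
  · simp only [bihomGE, iSup_le_iff]
    intro i j hi hj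
    exact Submodule.span_mono fun x hx => ⟨i, j, hi, hj, hx⟩
  · rw [Submodule.span_le]
    rintro x ⟨i, j, hi, hj, hx⟩
    have h1 : x ∈ bihom K i j := Submodule.subset_span hx
    have h2 : bihom K i j ≤ bihomGE K n m := by
      unfold bihomGE
      exact le_iSup_of_le i (le_iSup_of_le j (le_iSup_of_le hi (le_iSup_of_le hj le_rfl)))
    exact h2 h1

theorem aux_mono {n m n' m' : ℕ} (hn : n' ≤ n) (hm : m' ≤ m) :
    bihomGE K n m ≤ bihomGE K n' m' := by
  rw [aux_bihomGE_eq, aux_bihomGE_eq]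
  apply Submodule.span_mono
  rintro x ⟨i, j, hi, hj, hx⟩
  exact ⟨i, j, hn.trans hi, hm.trans hj, hx⟩

theorem aux_lie_mem {n m p q : ℕ} {x y : L K} (hx : x ∈ bihomGE K n m)
    (hy : y ∈ bihomGE K p q) : ⁅x, y⁆ ∈ bihomGE K (n + p) (m + q) := by
  rw [aux_bihomGE_eq] at hx hy
  refine aux_lie_span K ?_ hx hy
  rintro x ⟨i, j, hi, hj, hx⟩ y ⟨k, l, hk, hl, hy⟩
  rw [aux_bihomGE_eq]
  exact Submodule.subset_span ⟨_, _, add_le_add hi hk, add_le_add hj hl, hx.brak hy⟩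

theorem aux_top (x : L K) : x ∈ bihomGE K 0 0 := by
  have hA : ∀ x y : L K, x ∈ bihomGE K 0 0 → y ∈ bihomGE K 0 0 → ⁅x, y⁆ ∈ bihomGE K 0 0 := by
    intro x y hx hy
    have h := aux_lie_mem K hx hy
    rw [Nat.add_zero] at h
    exact h
  let A : LieSubalgebra K (L K) :=
    { bihomGE K 0 0 with lie_mem' := fun {x y} hx hy => hA x y hx hy }
  have he : e K ∈ A := by
    change e K ∈ bihomGE K 0 0
    rw [aux_bihomGE_eq]
    exact Submodule.subset_span ⟨1, 0, by simp, by simp, .gen_e⟩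
  have hf : f K ∈ A := by
    change f K ∈ bihomGE K 0 0
    rw [aux_bihomGE_eq]
    exact Submodule.subset_span ⟨0, 1, by simp, by simp, .gen_f⟩
  let g : L K →ₗ⁅K⁆ A := FreeLieAlgebra.lift K ![⟨e K, he⟩, ⟨f K, hf⟩]
  have hg : A.incl.comp g = LieHom.id := by
    apply FreeLieAlgebra.hom_ext
    intro i
    fin_cases i <;> simp [g, e, f]
  have h2 : ((g x : A) : L K) = x := LieHom.congr_fun hg x
  rw [← h2]
  exact (g x).2

theorem aux_pure {x : L K} {i j : ℕ} (h : IsLieMonomial K x i j) :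
    (j = 0 → ∃ c : K, x = c • e K) ∧ (i = 0 → ∃ c : K, x = c • f K) := by
  induction h with
  | gen_e => exact ⟨fun _ => ⟨1, by simp⟩, by simp⟩
  | gen_f => exact ⟨by simp, fun _ => ⟨1, by simp⟩⟩
  | brak _ _ ih1 ih2 =>
    constructor
    · intro h
      obtain ⟨c, rfl⟩ := ih1.1 (by omega)
      obtain ⟨d, rfl⟩ := ih2.1 (by omega)
      exact ⟨0, by simp⟩
    · intro h
      obtain ⟨c, rfl⟩ := ih1.2 (by omega)
      obtain ⟨d, rfl⟩ := ih2.2 (by omega)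
      exact ⟨0, by simp⟩

theorem aux_lie11 (x y : L K) : ⁅x, y⁆ ∈ bihomGE K 1 1 := by
  have hx := aux_top K x
  have hy := aux_top K y
  rw [aux_bihomGE_eq] at hx hy
  refine aux_lie_span K ?_ hx hy
  rintro x ⟨i, j, -, -, hx⟩ y ⟨k, l, -, -, hy⟩
  by_cases h1 : j + l = 0
  · obtain ⟨c, rfl⟩ := (aux_pure K hx).1 (by omega)
    obtain ⟨d, rfl⟩ := (aux_pure K hy).1 (by omega)
    simp
  by_cases h2 : i + k = 0
  · obtain ⟨c, rfl⟩ := (aux_pure K hx).2 (by omega)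
    obtain ⟨d, rfl⟩ := (aux_pure K hy).2 (by omega)
    simp
  rw [aux_bihomGE_eq]
  exact Submodule.subset_span ⟨_, _, by omega, by omega, hx.brak hy⟩

theorem aux_lcs {x : L K} (hx : x ∈ lcs K 2) : x ∈ bihomGE K 1 1 := by
  have h : x ∈ ⁅(⊤ : LieIdeal K (L K)), (⊤ : LieSubmodule K (L K) (L K))⁆ := by
    simpa [lcs, LieModule.lowerCentralSeries_succ] using hx
  rw [← LieSubmodule.mem_toSubmodule, LieSubmodule.lieIdeal_oper_eq_linear_span'] at h
  refine Submodule.span_le.2 ?_ h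
  rintro _ ⟨y, -, z, -, rfl⟩
  exact aux_lie11 K y z

theorem aux_sup {i j k l : ℕ} {x y : L K} (hx : x ∈ bihomGE K (i + 1) j ⊔ bihomGE K i (j + 1))
    (hy : y ∈ bihomGE K k l) :
    ⁅x, y⁆ ∈ bihomGE K (i + k + 1) (j + l) ⊔ bihomGE K (i + k) (j + l + 1) := by
  obtain ⟨u, hu, v, hv, rfl⟩ := Submodule.mem_sup.1 hx
  rw [add_lie]
  refine Submodule.add_mem_sup ?_ ?_
  · exact aux_mono K (by omega) (by omega) (aux_lie_mem K hu hy)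
  · exact aux_mono K (by omega) (by omega) (aux_lie_mem K hv hy)

theorem aux_sup_le (i j : ℕ) : bihomGE K (i + 1) j ⊔ bihomGE K i (j + 1) ≤ bihomGE K i j :=
  sup_le (aux_mono K (by omega) le_rfl) (aux_mono K le_rfl (by omega))

theorem aux_main (φ : L K →ₗ⁅K⁆ L K) (a b : K)
    (he : φ (e K) - a • e K ∈ lcs K 2) (hf : φ (f K) - b • f K ∈ lcs K 2)
    {x : L K} {i j : ℕ} (h : IsLieMonomial K x i j) :
    φ x - (a ^ i * b ^ j) • x ∈ bihomGE K (i + 1) j ⊔ bihomGE K i (j + 1) := by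
  induction h with
  | gen_e => simpa using Submodule.mem_sup_right (aux_lcs K he)
  | gen_f => simpa using Submodule.mem_sup_left (aux_lcs K hf)
  | @brak x y i j k l hx hy ih1 ih2 =>
    have hx' : x ∈ bihomGE K i j := by
      rw [aux_bihomGE_eq]; exact Submodule.subset_span ⟨_, _, le_rfl, le_rfl, hx⟩
    have hy' : y ∈ bihomGE K k l := by
      rw [aux_bihomGE_eq]; exact Submodule.subset_span ⟨_, _, le_rfl, le_rfl, hy⟩
    have hφy : φ y ∈ bihomGE K k l := by
      have := Submodule.add_mem _ (aux_sup_le K k l ih2)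
        (Submodule.smul_mem _ (a ^ k * b ^ l) hy')
      simpa using this
    have h1 := aux_sup K ih1 hφy
    have h2 := aux_sup K ih2 (Submodule.smul_mem _ (a ^ i * b ^ j) hx')
    rw [add_comm k i, add_comm l j] at h2
    have h3 := Submodule.sub_mem _ h1 h2
    convert h3 using 1
    rw [LieHom.map_lie, ← lie_skew (φ y - (a ^ k * b ^ l) • y)]
    simp only [sub_lie, lie_sub, smul_lie, lie_smul, smul_smul]
    rw [show a ^ (i + k) * b ^ (j + l) = a ^ k * b ^ l * (a ^ i * b ^ j) by ring]
    abel

/-- If a Lie algebra endomorphism `φ` satisfies `φ(e) ≡ a • e` and `φ(f) ≡ b • f`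
modulo `L² = ⁅L, L⁆`, then for `l ∈ L_{i,j}` we have
`φ(l) - aⁱbʲ • l ∈ L_{≥i+1,≥j} + L_{≥i,≥j+1}`; in particular, for `l ∈ L_{i,j}` with
`i, j ≥ n`, `φ(l) ≡ aⁱbʲ • l` modulo `L_{≥n,≥n}`. -/
theorem endo_congr_bihom (φ : L K →ₗ⁅K⁆ L K) (a b : K)
    (he : φ (e K) - a • e K ∈ lcs K 2) (hf : φ (f K) - b • f K ∈ lcs K 2) :
    (∀ i j : ℕ, ∀ l ∈ bihom K i j,
      φ l - (a ^ i * b ^ j) • l ∈ bihomGE K (i + 1) j ⊔ bihomGE K i (j + 1)) ∧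
    (∀ n i j : ℕ, n ≤ i → n ≤ j → ∀ l ∈ bihom K i j,
      φ l - (a ^ i * b ^ j) • l ∈ bihomGE K n n) := by
  have key : ∀ i j : ℕ, ∀ l ∈ bihom K i j,
      φ l - (a ^ i * b ^ j) • l ∈ bihomGE K (i + 1) j ⊔ bihomGE K i (j + 1) := by
    intro i j l hl
    unfold bihom at hl
    induction hl using Submodule.span_induction with
    | mem x hx => exact aux_main K φ a b he hf hx
    | zero => simp
    | add x y _ _ hx hy =>
      have h := Submodule.add_mem _ hx hy
      rw [map_add, smul_add, add_sub_add_comm]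
      exact h
    | smul t x _ hx =>
      have h := Submodule.smul_mem _ t hx
      rw [map_smul, smul_comm, ← smul_sub]
      exact h
  exact ⟨key, fun n i j hi hj l hl => aux_mono K hi hj (aux_sup_le K i j (key i j l hl))⟩

end CMPaper
end
end

section
/- Let L be the free Lie algebra over a field K of characteristic zero on two generators e and f. Then for every n ≥ 3, the n-th term L^n of the lower central series satisfies L^n ⊆ span_K{ ad(e)^{n−2}(⁅e,f⁆), ad(f)^{n−2}(⁅e,f⁆) } + L^{n+1} + L_{≥2,≥2}. Moreover, for n = 2 one has L^2 ⊆ span_K{ ⁅e,f⁆ } + L^3 + L_{≥2,≥2}. -/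
noncomputable section

namespace CMPaper

variable (K : Type*) [Field K] [CharZero K]

theorem subalg_top (H : LieSubalgebra K (L K)) (he : e K ∈ H) (hf : f K ∈ H) (x : L K) :
    x ∈ H := by
  let g : Fin 2 → H := ![⟨e K, he⟩, ⟨f K, hf⟩]
  have h : H.incl.comp (FreeLieAlgebra.lift K g) = (LieHom.id : L K →ₗ⁅K⁆ L K) := by
    apply FreeLieAlgebra.hom_ext
    intro i
    rw [LieHom.comp_apply, FreeLieAlgebra.lift_of_apply]
    fin_cases i <;> rfl
  have h2 := LieHom.congr_fun h x
  rw [LieHom.comp_apply] at h2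
  have h3 : x = H.incl (FreeLieAlgebra.lift K g x) := h2.symm
  rw [h3]
  exact (FreeLieAlgebra.lift K g x).2

/-- Shorthand for the terms of the lower central series. -/
abbrev C (k : ℕ) : LieIdeal K (L K) := LieModule.lowerCentralSeries K (L K) (L K) k

theorem lie_mem_C (k : ℕ) (x y : L K) (hy : y ∈ C K k) : ⁅x, y⁆ ∈ C K (k + 1) := by
  rw [C, LieModule.lowerCentralSeries_succ]
  exact LieSubmodule.lie_mem_lie (LieSubmodule.mem_top x) hy

/-- `L^{k+1}` is contained in any submodule containing `⁅e, L^k⁆` and `⁅f, L^k⁆`. -/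
theorem C_succ_le (k : ℕ) (S : Submodule K (L K))
    (he : ∀ m ∈ C K k, ⁅e K, m⁆ ∈ S) (hf : ∀ m ∈ C K k, ⁅f K, m⁆ ∈ S) :
    (C K (k + 1) : Submodule K (L K)) ≤ S := by
  let H : LieSubalgebra K (L K) :=
    { carrier := {x | ∀ m ∈ C K k, ⁅x, m⁆ ∈ S}
      add_mem' := by
        intro a b ha hb m hm
        rw [add_lie]
        exact S.add_mem (ha m hm) (hb m hm)
      zero_mem' := by
        intro m hm
        rw [zero_lie]
        exact S.zero_mem
      smul_mem' := by
        intro c a ha m hm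
        rw [smul_lie]
        exact S.smul_mem c (ha m hm)
      lie_mem' := by
        intro a b ha hb m hm
        rw [lie_lie]
        exact S.sub_mem (ha _ ((C K k).lie_mem hm)) (hb _ ((C K k).lie_mem hm)) }
  change (C K (k + 1)).toSubmodule ≤ S
  rw [C, LieModule.lowerCentralSeries_succ, LieSubmodule.lieIdeal_oper_eq_linear_span',
    Submodule.span_le]
  rintro _ ⟨x, -, m, hm, rfl⟩
  exact subalg_top K H he hf x m hm

theorem top_le (x : L K) : x ∈ Submodule.span K {e K, f K} ⊔ (C K 1 : Submodule K (L K)) := by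
  let H : LieSubalgebra K (L K) :=
    { Submodule.span K {e K, f K} ⊔ (C K 1 : Submodule K (L K)) with
      lie_mem' := by
        intro a b _ _
        exact Submodule.mem_sup_right (lie_mem_C K 0 a b (by simp)) }
  refine subalg_top K H ?_ ?_ x
  · exact Submodule.mem_sup_left (Submodule.subset_span (by simp))
  · exact Submodule.mem_sup_left (Submodule.subset_span (by simp))

theorem mono_mem {x : L K} {i j : ℕ} (h : IsLieMonomial K x i j) (hi : 2 ≤ i) (hj : 2 ≤ j) :
    x ∈ bihomGE K 2 2 := by
  have h1 : x ∈ bihom K i j := Submodule.subset_span h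
  have h2 : bihom K i j ≤ bihomGE K 2 2 :=
    le_iSup_of_le i (le_iSup_of_le j (le_iSup_of_le hi (le_iSup_of_le hj le_rfl)))
  exact h2 h1

theorem lie_mem_GE {g : L K} {a b : ℕ} (hg : IsLieMonomial K g a b) {x : L K}
    (hx : x ∈ bihomGE K 2 2) : ⁅g, x⁆ ∈ bihomGE K 2 2 := by
  have : bihomGE K 2 2 ≤ (bihomGE K 2 2).comap (LieAlgebra.ad K (L K) g) := by
    conv_lhs => unfold bihomGE
    refine iSup_le fun i => iSup_le fun j => iSup_le fun hi => iSup_le fun hj => ?_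
    unfold bihom
    rw [Submodule.span_le]
    intro y hy
    exact mono_mem K (hg.brak hy) (by omega) (by omega)
  exact this hx

theorem mono_e (k : ℕ) :
    IsLieMonomial K (((LieAlgebra.ad K (L K) (e K)) ^ k) ⁅e K, f K⁆) (k + 1) 1 := by
  induction k with
  | zero => exact IsLieMonomial.gen_e.brak IsLieMonomial.gen_f
  | succ k ih =>
    rw [pow_succ', Module.End.mul_apply, LieAlgebra.ad_apply]
    have := IsLieMonomial.gen_e.brak ih
    rwa [show 1 + (k + 1) = k + 1 + 1 by omega, Nat.zero_add] at this

theorem mono_f (k : ℕ) :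
    IsLieMonomial K (((LieAlgebra.ad K (L K) (f K)) ^ k) ⁅e K, f K⁆) 1 (k + 1) := by
  induction k with
  | zero => exact IsLieMonomial.gen_e.brak IsLieMonomial.gen_f
  | succ k ih =>
    rw [pow_succ', Module.End.mul_apply, LieAlgebra.ad_apply]
    have := IsLieMonomial.gen_f.brak ih
    rwa [show 1 + (k + 1) = k + 1 + 1 by omega, Nat.zero_add] at this

/-- The right-hand side. -/
def R (k : ℕ) : Submodule K (L K) :=
  Submodule.span K
    {((LieAlgebra.ad K (L K) (e K)) ^ k) ⁅e K, f K⁆,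
     ((LieAlgebra.ad K (L K) (f K)) ^ k) ⁅e K, f K⁆} ⊔
    (C K (k + 2) : Submodule K (L K)) ⊔ bihomGE K 2 2

theorem step (k : ℕ) (g : L K) {a b : ℕ} (hg : IsLieMonomial K g a b)
    (h1 : ⁅g, ((LieAlgebra.ad K (L K) (e K)) ^ k) ⁅e K, f K⁆⁆ ∈ R K (k + 1))
    (h2 : ⁅g, ((LieAlgebra.ad K (L K) (f K)) ^ k) ⁅e K, f K⁆⁆ ∈ R K (k + 1)) :
    R K k ≤ (R K (k + 1)).comap (LieAlgebra.ad K (L K) g) := by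
  conv_lhs => unfold R
  refine sup_le (sup_le ?_ ?_) ?_
  · rw [Submodule.span_le]
    rintro y (rfl | rfl)
    · exact h1
    · exact h2
  · intro y hy
    exact Submodule.mem_sup_left (Submodule.mem_sup_right (lie_mem_C K (k + 2) g y hy))
  · intro y hy
    exact Submodule.mem_sup_right (lie_mem_GE K hg hy)

theorem self_e (k : ℕ) : ⁅e K, ((LieAlgebra.ad K (L K) (e K)) ^ k) ⁅e K, f K⁆⁆ ∈ R K (k + 1) := by
  rw [← LieAlgebra.ad_apply (R := K), ← Module.End.mul_apply, ← pow_succ']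
  exact Submodule.mem_sup_left (Submodule.mem_sup_left (Submodule.subset_span (by simp)))

theorem self_f (k : ℕ) : ⁅f K, ((LieAlgebra.ad K (L K) (f K)) ^ k) ⁅e K, f K⁆⁆ ∈ R K (k + 1) := by
  rw [← LieAlgebra.ad_apply (R := K), ← Module.End.mul_apply, ← pow_succ']
  exact Submodule.mem_sup_left (Submodule.mem_sup_left (Submodule.subset_span (by simp)))

theorem cross_e (k : ℕ) : ⁅e K, ((LieAlgebra.ad K (L K) (f K)) ^ k) ⁅e K, f K⁆⁆ ∈ R K (k + 1) := by
  cases k with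
  | zero => exact self_e K 0
  | succ k =>
    exact Submodule.mem_sup_right
      (mono_mem K (IsLieMonomial.gen_e.brak (mono_f K (k + 1))) (by omega) (by omega))

theorem cross_f (k : ℕ) : ⁅f K, ((LieAlgebra.ad K (L K) (e K)) ^ k) ⁅e K, f K⁆⁆ ∈ R K (k + 1) := by
  cases k with
  | zero => exact self_f K 0
  | succ k =>
    exact Submodule.mem_sup_right
      (mono_mem K (IsLieMonomial.gen_f.brak (mono_e K (k + 1))) (by omega) (by omega))

theorem base_lie (g : L K) (h1 : ⁅g, e K⁆ ∈ R K 0) (h2 : ⁅g, f K⁆ ∈ R K 0) (m : L K) :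
    ⁅g, m⁆ ∈ R K 0 := by
  have : Submodule.span K {e K, f K} ⊔ (C K 1 : Submodule K (L K)) ≤
      (R K 0).comap (LieAlgebra.ad K (L K) g) := by
    refine sup_le ?_ ?_
    · rw [Submodule.span_le]
      rintro y (rfl | rfl)
      · exact h1
      · exact h2
    · intro y hy
      exact Submodule.mem_sup_left (Submodule.mem_sup_right (lie_mem_C K 1 g y hy))
  exact this (top_le K m)

theorem main_le (k : ℕ) : (C K (k + 1) : Submodule K (L K)) ≤ R K k := by
  induction k with
  | zero =>
    have hef : ⁅e K, f K⁆ ∈ R K 0 :=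
      Submodule.mem_sup_left (Submodule.mem_sup_left (Submodule.subset_span (by simp)))
    refine C_succ_le K 0 _ (fun m _ => base_lie K _ ?_ hef m) (fun m _ => base_lie K _ ?_ ?_ m)
    · rw [lie_self]; exact Submodule.zero_mem _
    · rw [← lie_skew]; exact Submodule.neg_mem _ hef
    · rw [lie_self]; exact Submodule.zero_mem _
  | succ k ih =>
    exact C_succ_le K (k + 1) _
      (fun m hm => step K k _ IsLieMonomial.gen_e (self_e K k) (cross_e K k) (ih hm))
      (fun m hm => step K k _ IsLieMonomial.gen_f (cross_f K k) (self_f K k) (ih hm))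

/-- For `n ≥ 3`, `L^n` is contained in the span of `ad(e)^{n-2}(⁅e,f⁆)` and
`ad(f)^{n-2}(⁅e,f⁆)` together with `L^{n+1} + L_{≥2,≥2}`; and
`L² ⊆ span{⁅e,f⁆} + L³ + L_{≥2,≥2}`. -/
theorem lcs_le_span_ad_sup :
    (∀ n : ℕ, 3 ≤ n →
      (lcs K n : Submodule K (L K)) ≤
        Submodule.span K
            {((LieAlgebra.ad K (L K) (e K)) ^ (n - 2)) ⁅e K, f K⁆,
             ((LieAlgebra.ad K (L K) (f K)) ^ (n - 2)) ⁅e K, f K⁆} ⊔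
          (lcs K (n + 1) : Submodule K (L K)) ⊔ bihomGE K 2 2) ∧
    (lcs K 2 : Submodule K (L K)) ≤
      Submodule.span K {⁅e K, f K⁆} ⊔ (lcs K 3 : Submodule K (L K)) ⊔ bihomGE K 2 2 := by
  constructor
  · intro n hn
    obtain ⟨k, rfl⟩ : ∃ k, n = k + 2 := ⟨n - 2, by omega⟩
    exact main_le K k
  · have h := main_le K 0
    have h2 : R K 0 = Submodule.span K {⁅e K, f K⁆} ⊔ (lcs K 3 : Submodule K (L K)) ⊔
        bihomGE K 2 2 := by
      simp [R, lcs]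
    rw [h2] at h
    exact h

end CMPaper
end
end

section
/- Let L be the free Lie algebra over a field K of characteristic zero on two generators e and f. The bracket ⁅e,f⁆ does not lie in L^3 + L_{≥2,≥2}; consequently the quotient K-module L^2 / (L^3 + (L^2 ⊓ L_{≥2,≥2})) is one-dimensional, spanned by the class of ⁅e,f⁆. -/
noncomputable section

namespace CMPaper

variable (K : Type*) [Field K] [CharZero K]

attribute [local instance 100] LieRing.ofAssociativeRing

lemma subalg_eq_top (S : LieSubalgebra K (L K)) (he : e K ∈ S) (hf : f K ∈ S) (x : L K) :
    x ∈ S := by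
  let g : Fin 2 → S := ![⟨e K, he⟩, ⟨f K, hf⟩]
  have h : S.incl.comp (FreeLieAlgebra.lift K g) = LieHom.id := by
    apply FreeLieAlgebra.hom_ext
    intro i
    fin_cases i
    · simp [g]; rfl
    · simp [g]; rfl
  have h2 : ((FreeLieAlgebra.lift K g x : S) : L K) = x := LieHom.congr_fun h x
  rw [← h2]
  exact Subtype.property _

lemma lie_mem_two (x y : L K) : ⁅x, y⁆ ∈ lcs K 2 :=
  LieSubmodule.lie_mem_lie (LieSubmodule.mem_top x) (LieSubmodule.mem_top y)

lemma lie_mem_three (x y : L K) (hy : y ∈ lcs K 2) : ⁅x, y⁆ ∈ lcs K 3 :=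
  LieSubmodule.lie_mem_lie (LieSubmodule.mem_top x) hy

lemma lie_mem_three' (x y : L K) (hx : x ∈ lcs K 2) : ⁅x, y⁆ ∈ lcs K 3 := by
  rw [← lie_skew]
  exact neg_mem (lie_mem_three K y x hx)

lemma monomial_two {x : L K} {i j : ℕ} (h : IsLieMonomial K x i j) (hij : 2 ≤ i + j) :
    x ∈ lcs K 2 := by
  cases h with
  | gen_e => omega
  | gen_f => omega
  | brak _ _ => exact lie_mem_two K _ _

lemma monomial_three {x : L K} {i j : ℕ} (h : IsLieMonomial K x i j) (hij : 3 ≤ i + j) :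
    x ∈ lcs K 3 := by
  cases h with
  | gen_e => omega
  | gen_f => omega
  | @brak x y i j k l hx hy =>
    by_cases h : 2 ≤ i + j
    · exact lie_mem_three' K _ _ (monomial_two K hx h)
    · exact lie_mem_three K _ _ (monomial_two K hy (by omega))

lemma bihomGE_le : bihomGE K 2 2 ≤ (lcs K 3 : Submodule K (L K)) := by
  unfold bihomGE bihom
  refine iSup_le fun i => iSup_le fun j => iSup_le fun hi => iSup_le fun hj => ?_
  rw [Submodule.span_le]
  intro x hx
  exact monomial_three K hx (by omega)

lemma lcs_three_le : (lcs K 3 : Submodule K (L K)) ≤ (lcs K 2 : Submodule K (L K)) :=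
  LieModule.antitone_lowerCentralSeries K (L K) (L K) (by norm_num)

/-- The Lie subalgebra spanned by the generators and the derived algebra. -/
def genSub : LieSubalgebra K (L K) where
  toSubmodule := Submodule.span K {e K, f K} ⊔ (lcs K 2 : Submodule K (L K))
  lie_mem' := fun {x y} _ _ => Submodule.mem_sup_right (lie_mem_two K x y)

lemma decomp (x : L K) : ∃ a b : K, ∃ z ∈ lcs K 2, x = a • e K + b • f K + z := by
  have h : x ∈ genSub K := subalg_eq_top K _
    (Submodule.mem_sup_left (Submodule.subset_span (by simp)))
    (Submodule.mem_sup_left (Submodule.subset_span (by simp))) x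
  obtain ⟨y, hy, z, hz, rfl⟩ := Submodule.mem_sup.1 h
  obtain ⟨a, b, rfl⟩ := Submodule.mem_span_pair.1 hy
  exact ⟨a, b, z, hz, rfl⟩

lemma lie_decomp (x y : L K) : ∃ c : K, ⁅x, y⁆ - c • ⁅e K, f K⁆ ∈ lcs K 3 := by
  obtain ⟨a, b, z, hz, rfl⟩ := decomp K x
  obtain ⟨a', b', z', hz', rfl⟩ := decomp K y
  refine ⟨a * b' - b * a', ?_⟩
  have h : ⁅a • e K + b • f K + z, a' • e K + b' • f K + z'⁆ - (a * b' - b * a') • ⁅e K, f K⁆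
      = ⁅a • e K + b • f K + z, z'⁆ + ⁅z, a' • e K + b' • f K⁆ := by
    have : ⁅f K, e K⁆ = -⁅e K, f K⁆ := (lie_skew _ _).symm
    simp only [lie_add, add_lie, smul_lie, lie_smul, lie_self, this, smul_zero]
    module
  rw [h]
  exact add_mem (lie_mem_three K _ _ hz') (lie_mem_three' K _ _ hz)

lemma lcs_two_le : (lcs K 2 : Submodule K (L K)) ≤
    (lcs K 3 : Submodule K (L K)) ⊔ Submodule.span K {⁅e K, f K⁆} := by
  have : (lcs K 2 : Submodule K (L K)) =
      Submodule.span K {⁅x, n⁆ | (x ∈ (⊤ : LieIdeal K (L K))) (n ∈ (⊤ : LieIdeal K (L K)))} :=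
    LieSubmodule.lieIdeal_oper_eq_linear_span' (⊤ : LieIdeal K (L K)) (⊤ : LieIdeal K (L K))
  rw [this, Submodule.span_le]
  rintro _ ⟨x, -, y, -, rfl⟩
  obtain ⟨c, hc⟩ := lie_decomp K x y
  exact Submodule.mem_sup.2 ⟨_, hc, c • ⁅e K, f K⁆,
    Submodule.smul_mem _ _ (Submodule.mem_span_singleton_self _), by abel⟩

/-- The representation onto the Heisenberg algebra. -/
def phi : L K →ₗ⁅K⁆ Matrix (Fin 3) (Fin 3) K :=
  FreeLieAlgebra.lift K ![!![0, 1, 0; 0, 0, 0; 0, 0, 0], !![0, 0, 0; 0, 0, 1; 0, 0, 0]]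

lemma phi_e : phi K (e K) = !![0, 1, 0; 0, 0, 0; 0, 0, 0] := by
  simp [phi, e]

lemma phi_f : phi K (f K) = !![0, 0, 0; 0, 0, 1; 0, 0, 0] := by
  simp [phi, f]

/-- Elements with strictly upper triangular image. -/
def upper : LieSubalgebra K (L K) where
  carrier := {x | ∀ i j, j ≤ i → phi K x i j = 0}
  add_mem' := fun {x y} hx hy i j h => by simp [hx i j h, hy i j h]
  zero_mem' := fun i j h => by simp
  smul_mem' := fun c x hx i j h => by simp [hx i j h]
  lie_mem' := fun {x y} hx hy i j h => by
    have hx : ∀ i j, j ≤ i → phi K x i j = 0 := hx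
    have hy : ∀ i j, j ≤ i → phi K y i j = 0 := hy
    rw [LieHom.map_lie, LieRing.of_associative_ring_bracket]
    fin_cases i <;> fin_cases j <;> simp_all [Matrix.mul_apply, Fin.sum_univ_three]

lemma phi_upper (x : L K) : ∀ i j, j ≤ i → phi K x i j = 0 := by
  refine subalg_eq_top K (upper K) ?_ ?_ x
  · intro i j h
    rw [phi_e]
    fin_cases i <;> fin_cases j <;> simp_all
  · intro i j h
    rw [phi_f]
    fin_cases i <;> fin_cases j <;> simp_all

lemma phi_lie (x y : L K) (i j : Fin 3) (h : ¬ (i = 0 ∧ j = 2)) : phi K ⁅x, y⁆ i j = 0 := by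
  have hx := phi_upper K x
  have hy := phi_upper K y
  rw [LieHom.map_lie, LieRing.of_associative_ring_bracket]
  fin_cases i <;> fin_cases j <;> simp_all [Matrix.mul_apply, Fin.sum_univ_three]

/-- Elements with central image. -/
def centralIdeal : LieIdeal K (L K) where
  carrier := {x | ∀ i j : Fin 3, ¬ (i = 0 ∧ j = 2) → phi K x i j = 0}
  add_mem' := fun {x y} hx hy i j h => by simp [hx i j h, hy i j h]
  zero_mem' := fun i j h => by simp
  smul_mem' := fun c x hx i j h => by simp [hx i j h]
  lie_mem := fun {x y} _ => phi_lie K x y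

lemma lcs_two_le_central : lcs K 2 ≤ centralIdeal K :=
  (LieSubmodule.lie_le_iff _ _ _).2 fun x _ y _ => phi_lie K x y

lemma lcs_three_le_ker : lcs K 3 ≤ (phi K).ker := by
  refine (LieSubmodule.lie_le_iff _ _ _).2 fun x _ y hy => ?_
  have hx := phi_upper K x
  have hy : ∀ i j : Fin 3, ¬ (i = 0 ∧ j = 2) → phi K y i j = 0 := lcs_two_le_central K hy
  rw [LieHom.mem_ker, LieHom.map_lie, LieRing.of_associative_ring_bracket]
  ext i j
  fin_cases i <;> fin_cases j <;> simp_all [Matrix.mul_apply, Fin.sum_univ_three]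

lemma ef_not_mem : ⁅e K, f K⁆ ∉ (lcs K 3 : Submodule K (L K)) := by
  intro h
  have h2 : phi K ⁅e K, f K⁆ = 0 := (LieHom.mem_ker ..).1 (lcs_three_le_ker K h)
  rw [LieHom.map_lie, LieRing.of_associative_ring_bracket, phi_e, phi_f] at h2
  have := congrFun (congrFun h2 0) 2
  simp [Matrix.mul_apply, Fin.sum_univ_three] at this

/-- `⁅e,f⁆ ∉ L³ + L_{≥2,≥2}`; consequently the quotient
`L² / (L³ + (L² ⊓ L_{≥2,≥2}))`, realized as the image of `L²` in
`L / (L³ + (L² ⊓ L_{≥2,≥2}))`, is one-dimensional, spanned by the class of `⁅e,f⁆`. -/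
theorem bracket_ef_not_mem_and_quotient_one_dim :
    ⁅e K, f K⁆ ∉ (lcs K 3 : Submodule K (L K)) ⊔ bihomGE K 2 2 ∧
    ((lcs K 2 : Submodule K (L K)).map
        ((lcs K 3 : Submodule K (L K)) ⊔
          ((lcs K 2 : Submodule K (L K)) ⊓ bihomGE K 2 2)).mkQ =
      Submodule.span K
        {((lcs K 3 : Submodule K (L K)) ⊔
            ((lcs K 2 : Submodule K (L K)) ⊓ bihomGE K 2 2)).mkQ ⁅e K, f K⁆}) ∧
    ((lcs K 3 : Submodule K (L K)) ⊔
        ((lcs K 2 : Submodule K (L K)) ⊓ bihomGE K 2 2)).mkQ ⁅e K, f K⁆ ≠ 0 ∧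
    Module.finrank K
      ↥((lcs K 2 : Submodule K (L K)).map
        ((lcs K 3 : Submodule K (L K)) ⊔
          ((lcs K 2 : Submodule K (L K)) ⊓ bihomGE K 2 2)).mkQ) = 1 := by
  have h1 : (lcs K 3 : Submodule K (L K)) ⊔ bihomGE K 2 2 = (lcs K 3 : Submodule K (L K)) :=
    sup_eq_left.2 (bihomGE_le K)
  have h2 : (lcs K 3 : Submodule K (L K)) ⊔ ((lcs K 2 : Submodule K (L K)) ⊓ bihomGE K 2 2) =
      (lcs K 3 : Submodule K (L K)) :=
    sup_eq_left.2 (inf_le_right.trans (bihomGE_le K))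
  rw [h1, h2]
  have hne : (lcs K 3 : Submodule K (L K)).mkQ ⁅e K, f K⁆ ≠ 0 := by
    rw [Submodule.mkQ_apply, Ne, Submodule.Quotient.mk_eq_zero]
    exact ef_not_mem K
  have hspan : (lcs K 2 : Submodule K (L K)).map (lcs K 3 : Submodule K (L K)).mkQ =
      Submodule.span K {(lcs K 3 : Submodule K (L K)).mkQ ⁅e K, f K⁆} := by
    apply le_antisymm
    · refine (Submodule.map_mono (lcs_two_le K)).trans ?_
      rw [Submodule.map_sup, Submodule.mkQ_map_self, bot_sup_eq, Submodule.map_span,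
        Set.image_singleton]
    · rw [Submodule.span_singleton_le_iff_mem]
      exact Submodule.mem_map_of_mem (lie_mem_two K _ _)
  refine ⟨ef_not_mem K, hspan, hne, ?_⟩
  rw [hspan]
  exact finrank_span_singleton hne

end CMPaper
end
end
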